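/- arXiv:0801.2067 — 4 statements merged into one kernel-verified Lean document; each statement's English description precedes it below -/
import Mathlib

section
/- If R is a perfect ring (i.e., every flat R-module is projective), then the weak global dimension of R equals the global dimension of R. -/
open CategoryTheory Opposite

noncomputable section

universe u

variable (R : Type u) [CommRing R]

/-- `ExtVanish R M N n` : the `n`-th Ext group `Ext^n_R(M, N)` vanishes. -/
def ExtVanish (M N : ModuleCat.{u} R) (n : ℕ) : Prop :=
  Subsingleton (((Ext R (ModuleCat.{u} R) n).obj (op M)).obj N)

/-- `TorVanish R M N n` : the `n`-th Tor group `Tor_n^R(M, N)` vanishes. -/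
def TorVanish (M N : ModuleCat.{u} R) (n : ℕ) : Prop :=
  Subsingleton (((Tor (ModuleCat.{u} R) n).obj M).obj N)

/-- `pdLE R M n` : the projective dimension of `M` is at most `n`. -/
def pdLE (M : ModuleCat.{u} R) (n : ℕ) : Prop :=
  ∀ N : ModuleCat.{u} R, ExtVanish R M N (n + 1)

/-- `idLE R M n` : the injective dimension of `M` is at most `n`. -/
def idLE (M : ModuleCat.{u} R) (n : ℕ) : Prop :=
  ∀ N : ModuleCat.{u} R, ExtVanish R N M (n + 1)

/-- `fdLE R M n` : the flat dimension of `M` is at most `n`. -/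
def fdLE (M : ModuleCat.{u} R) (n : ℕ) : Prop :=
  ∀ N : ModuleCat.{u} R, TorVanish R M N (n + 1)

/-- `cdLE R M n` : the cotorsion dimension of `M` is at most `n`, i.e.
`Ext^{n+1}_R(F, M) = 0` for every flat `R`-module `F`. -/
def cdLE (M : ModuleCat.{u} R) (n : ℕ) : Prop :=
  ∀ F : ModuleCat.{u} R, Module.Flat R F → ExtVanish R F M (n + 1)

/-- The projective dimension of a module, as an element of `ℕ∞`. -/
def pd (M : ModuleCat.{u} R) : ℕ∞ := sInf ((↑) '' {n : ℕ | pdLE R M n})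

/-- The injective dimension of a module, as an element of `ℕ∞`. -/
def injd (M : ModuleCat.{u} R) : ℕ∞ := sInf ((↑) '' {n : ℕ | idLE R M n})

/-- The flat dimension of a module, as an element of `ℕ∞`. -/
def fd (M : ModuleCat.{u} R) : ℕ∞ := sInf ((↑) '' {n : ℕ | fdLE R M n})

/-- The cotorsion dimension of a module, as an element of `ℕ∞`. -/
def cd (M : ModuleCat.{u} R) : ℕ∞ := sInf ((↑) '' {n : ℕ | cdLE R M n})

/-- The global dimension of a ring. -/
def gldim : ℕ∞ := ⨆ M : ModuleCat.{u} R, pd R M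

/-- The weak global dimension of a ring. -/
def wdim : ℕ∞ := ⨆ M : ModuleCat.{u} R, fd R M

/-- The global cotorsion dimension of a ring: the supremum of the projective
dimensions of all flat modules. -/
def cotD : ℕ∞ := ⨆ (M : ModuleCat.{u} R) (_ : Module.Flat R M), pd R M

/-- The finitistic projective dimension of a ring. -/
def FPD : ℕ∞ := sSup {d : ℕ∞ | d ≠ ⊤ ∧ ∃ M : ModuleCat.{u} R, pd R M = d}

/-- The finitistic flat dimension of a ring. -/
def FFD : ℕ∞ := sSup {d : ℕ∞ | d ≠ ⊤ ∧ ∃ M : ModuleCat.{u} R, fd R M = d}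

/-- The finitistic injective dimension of a ring. -/
def FID : ℕ∞ := sSup {d : ℕ∞ | d ≠ ⊤ ∧ ∃ M : ModuleCat.{u} R, injd R M = d}

/-- The finitistic cotorsion dimension of a ring. -/
def FCD : ℕ∞ := sSup {d : ℕ∞ | d ≠ ⊤ ∧ ∃ M : ModuleCat.{u} R, cd R M = d}

/-- `R` is `n`-perfect if every flat `R`-module has projective dimension at most `n`. -/
def IsNPerfect (n : ℕ) : Prop :=
  ∀ M : ModuleCat.{u} R, Module.Flat R M → pd R M ≤ n

end

section Helpers

open CategoryTheory Limits MonoidalCategory TensorProduct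

/-- A contracting homotopy in degree `n + 1` only. -/
def HtpyAt {R : Type u} [CommRing R] (K : ChainComplex (ModuleCat.{u} R) ℕ) (n : ℕ) : Prop :=
  ∃ (s : K.X n ⟶ K.X (n + 1)) (t : K.X (n + 1) ⟶ K.X (n + 2)),
    t ≫ K.d (n + 2) (n + 1) + K.d (n + 1) n ≫ s = 𝟙 _

variable {R : Type u} [CommRing R]

lemma subsingleton_iff_isZero' (M : ModuleCat.{u} R) : Subsingleton M ↔ IsZero M :=
  ModuleCat.isZero_iff_subsingleton.symm

lemma torVanish_iff {M N : ModuleCat.{u} R} (P : ProjectiveResolution N) (n : ℕ) :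
    TorVanish R M N (n + 1) ↔
      Function.Exact (LinearMap.lTensor M (P.complex.d (n + 2) (n + 1)).hom)
        (LinearMap.lTensor M (P.complex.d (n + 1) n).hom) := by
  unfold TorVanish
  rw [subsingleton_iff_isZero']
  have e := P.isoLeftDerivedObj ((tensoringLeft (ModuleCat.{u} R)).obj M) (n + 1)
  rw [show ((Tor (ModuleCat.{u} R) (n+1)).obj M).obj N =
    (((tensoringLeft (ModuleCat.{u} R)).obj M).leftDerived (n+1)).obj N from rfl,
    e.isZero_iff]
  change IsZero (HomologicalComplex.homology _ _) ↔ _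
  rw [← HomologicalComplex.exactAt_iff_isZero_homology,
    HomologicalComplex.exactAt_iff' _ (n + 2) (n + 1) n (by simp only [ChainComplex.prev]; rfl) (by simp),
    ShortComplex.ShortExact.moduleCat_exact_iff_function_exact]
  rfl

lemma extVanish_iff {M N : ModuleCat.{u} R} (P : ProjectiveResolution M) (n : ℕ) :
    ExtVanish R M N (n + 1) ↔
      ∀ f : P.complex.X (n + 1) ⟶ N, P.complex.d (n + 2) (n + 1) ≫ f = 0 →
        ∃ g : P.complex.X n ⟶ N, P.complex.d (n + 1) n ≫ g = f := by
  unfold ExtVanish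
  rw [subsingleton_iff_isZero', (P.isoExt (R := R) (n + 1) N).isZero_iff,
    ← HomologicalComplex.exactAt_iff_isZero_homology,
    HomologicalComplex.exactAt_iff' _ n (n + 1) (n + 2) (by simp) (by simp only [CochainComplex.next]; rfl),
    ShortComplex.moduleCat_exact_iff]
  rfl

lemma HtpyAt.tor {M N : ModuleCat.{u} R} (P : ProjectiveResolution N) {n : ℕ}
    (h : HtpyAt P.complex n) : TorVanish R M N (n + 1) := by
  rw [torVanish_iff P]
  obtain ⟨s, t, h⟩ := h
  have h' := congrArg (fun f => LinearMap.lTensor M f.hom) h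
  simp only [ModuleCat.hom_add, ModuleCat.hom_comp, ModuleCat.hom_id, LinearMap.lTensor_add,
    LinearMap.lTensor_comp, LinearMap.lTensor_id] at h'
  intro x
  constructor
  · intro hx
    refine ⟨LinearMap.lTensor M t.hom x, ?_⟩
    have := LinearMap.congr_fun h' x
    simpa [hx] using this
  · rintro ⟨y, rfl⟩
    rw [← LinearMap.comp_apply, ← LinearMap.lTensor_comp, ← ModuleCat.hom_comp]
    simp

lemma HtpyAt.ext {M N : ModuleCat.{u} R} (P : ProjectiveResolution M) {n : ℕ}
    (h : HtpyAt P.complex n) : ExtVanish R M N (n + 1) := by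
  rw [extVanish_iff P]
  obtain ⟨s, t, h⟩ := h
  intro f hf
  refine ⟨s ≫ f, ?_⟩
  have := congrArg (· ≫ f) h
  simpa [hf] using this

lemma exists_lift {M : ModuleCat.{u} R} (P : ProjectiveResolution M) (n : ℕ)
    {Q : ModuleCat.{u} R} [Projective Q] (f : Q ⟶ P.complex.X (n + 1))
    (hf : f ≫ P.complex.d (n + 1) n = 0) :
    ∃ t : Q ⟶ P.complex.X (n + 2), t ≫ P.complex.d (n + 2) (n + 1) = f :=
  ⟨(P.exact_succ n).liftFromProjective f hf, (P.exact_succ n).liftFromProjective_comp f hf⟩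

lemma HtpyAt.of_s {M : ModuleCat.{u} R} (P : ProjectiveResolution M) {n : ℕ}
    (s : P.complex.X n ⟶ P.complex.X (n + 1))
    (hs : P.complex.d (n + 1) n ≫ s ≫ P.complex.d (n + 1) n = P.complex.d (n + 1) n) :
    HtpyAt P.complex n := by
  obtain ⟨t, ht⟩ := exists_lift P n (𝟙 _ - P.complex.d (n + 1) n ≫ s) (by simp [hs])
  exact ⟨s, t, by rw [ht]; abel⟩

lemma HtpyAt.succ {M : ModuleCat.{u} R} (P : ProjectiveResolution M) {n : ℕ}
    (h : HtpyAt P.complex n) : HtpyAt P.complex (n + 1) := by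
  obtain ⟨s, t, h⟩ := h
  refine HtpyAt.of_s P t ?_
  have := congrArg (P.complex.d (n + 2) (n + 1) ≫ ·) h
  simpa using this

lemma HtpyAt.mono {M : ModuleCat.{u} R} (P : ProjectiveResolution M) {m n : ℕ} (hmn : m ≤ n)
    (h : HtpyAt P.complex m) : HtpyAt P.complex n := by
  induction hmn with
  | refl => exact h
  | step _ ih => exact ih.succ P

lemma HtpyAt.of_ext {M : ModuleCat.{u} R} (P : ProjectiveResolution M) {n : ℕ}
    (h : pdLE R M n) : HtpyAt P.complex n := by
  let g := P.complex.d (n + 1) n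
  obtain ⟨r, hr⟩ := (extVanish_iff P n).1 (h (image g)) (factorThruImage g) (by
    rw [← cancel_mono (image.ι g)]; simp [g])
  -- `r` retracts the inclusion of the image
  have hr' : image.ι g ≫ r = 𝟙 _ := by
    rw [← cancel_epi (factorThruImage g)]
    simpa [g] using hr
  have : Projective (image g) := (Retract.mk (image.ι g) r hr').projective
  refine HtpyAt.of_s P (r ≫ Projective.factorThru (𝟙 _) (factorThruImage g)) ?_
  change g ≫ _ ≫ g = g
  have e : Projective.factorThru (𝟙 _) (factorThruImage g) ≫ g = image.ι g := by
    have h0 : Projective.factorThru (𝟙 _) (factorThruImage g) ≫ factorThruImage g ≫ image.ι g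
        = image.ι g := by
      rw [← Category.assoc, Projective.factorThru_comp, Category.id_comp]
    rwa [image.fac g] at h0
  rw [Category.assoc, e, ← Category.assoc, show g ≫ r = factorThruImage g from hr, image.fac]

lemma HtpyAt.of_projective {M : ModuleCat.{u} R} (P : ProjectiveResolution M) {n : ℕ}
    (h : Module.Projective R (P.complex.X n ⧸ LinearMap.range (P.complex.d (n + 1) n).hom)) :
    HtpyAt P.complex n := by
  set g := (P.complex.d (n + 1) n).hom with hg
  obtain ⟨c, hc⟩ := Module.projective_lifting_property (LinearMap.range g).mkQ LinearMap.id
    (Submodule.mkQ_surjective _)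
  have hc' : ∀ x, (LinearMap.range g).mkQ (c x) = x := fun x => LinearMap.congr_fun hc x
  have hp : Module.Projective R (P.complex.X n) :=
    (IsProjective.iff_projective _).2 (P.projective n)
  let q : P.complex.X n →ₗ[R] LinearMap.range g :=
    (LinearMap.id - c ∘ₗ (LinearMap.range g).mkQ).codRestrict _ (fun x => by
      rw [← Submodule.Quotient.mk_eq_zero, ← Submodule.mkQ_apply]
      simp only [LinearMap.sub_apply, LinearMap.comp_apply, map_sub, hc', LinearMap.id_apply,
        sub_self])
  obtain ⟨s, hs⟩ := Module.projective_lifting_property g.rangeRestrict q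
    g.surjective_rangeRestrict
  refine HtpyAt.of_s P (ModuleCat.ofHom s) ?_
  ext x
  have h1 := congrArg Subtype.val (LinearMap.congr_fun hs (g x))
  have h2 : (LinearMap.range g).mkQ (g x) = 0 := by simp
  simpa [q, h2] using h1

/-- Flatness of a cokernel from exactness after tensoring with cyclic modules. -/
lemma flat_coker {A B C : Type u} [AddCommGroup A] [AddCommGroup B] [AddCommGroup C]
    [Module R A] [Module R B] [Module R C] [Module.Flat R C] (f : A →ₗ[R] B) (g : B →ₗ[R] C)
    (hfg : g ∘ₗ f = 0)
    (H : ∀ I : Ideal R, Function.Exact (f.lTensor (R ⧸ I)) (g.lTensor (R ⧸ I))) :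
    Module.Flat R (C ⧸ LinearMap.range g) := by
  rw [Module.Flat.iff_rTensor_injective']
  intro I
  rw [injective_iff_map_eq_zero]
  intro x hx
  obtain ⟨y, rfl⟩ := LinearMap.lTensor_surjective I
    (Submodule.mkQ_surjective (LinearMap.range g)) x
  have exR : Function.Exact g (LinearMap.range g).mkQ := LinearMap.exact_map_mkQ_range g
  have ex (M : Type u) [AddCommGroup M] [Module R M] :
      Function.Exact (g.lTensor M) ((LinearMap.range g).mkQ.lTensor M) :=
    lTensor_exact M exR (Submodule.mkQ_surjective _)
  have exI (M : Type u) [AddCommGroup M] [Module R M] :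
      Function.Exact ((Submodule.subtype I).rTensor M) ((Submodule.mkQ I).rTensor M) :=
    rTensor_exact M (LinearMap.exact_subtype_mkQ I) (Submodule.mkQ_surjective _)
  have comm {S T U V : Type u} [AddCommGroup S] [AddCommGroup T] [AddCommGroup U] [AddCommGroup V]
      [Module R S] [Module R T] [Module R U] [Module R V] (a : S →ₗ[R] T) (b : U →ₗ[R] V)
      (z : S ⊗[R] U) : a.rTensor V (b.lTensor S z) = b.lTensor T (a.rTensor U z) := by
    rw [← LinearMap.comp_apply, ← LinearMap.comp_apply, LinearMap.rTensor_comp_lTensor,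
      LinearMap.lTensor_comp_rTensor]
  rw [comm] at hx
  -- `k` in `R ⊗ B`
  obtain ⟨k, hk⟩ := (ex R _).1 hx
  have h1 : g.lTensor (R ⧸ I) ((Submodule.mkQ I).rTensor B k) = 0 := by
    rw [← comm, hk]
    exact (exI C).apply_apply_eq_zero y
  obtain ⟨a, ha⟩ := (H I _).1 h1
  obtain ⟨a', rfl⟩ := LinearMap.rTensor_surjective A (Submodule.mkQ_surjective I) a
  rw [← comm] at ha
  have h2 : (Submodule.mkQ I).rTensor B (k - f.lTensor R a') = 0 := by
    rw [map_sub, ha, sub_self]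
  obtain ⟨z, hz⟩ := (exI B _).1 h2
  have h3 : (Submodule.subtype I).rTensor C (g.lTensor I z) = (Submodule.subtype I).rTensor C y := by
    rw [comm, hz, map_sub, hk, ← LinearMap.comp_apply (g.lTensor R), ← LinearMap.lTensor_comp,
      hfg]
    simp
  have h4 := Module.Flat.rTensor_preserves_injective_linearMap (M := C) (Submodule.subtype I)
    (Submodule.subtype_injective I) h3
  rw [← h4]
  exact (ex I).apply_apply_eq_zero z

/-- A single test module for flat dimension. -/
abbrev testMod (R : Type u) [CommRing R] : ModuleCat.{u} R :=
  ModuleCat.of R (Π₀ I : Ideal R, R ⧸ I)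

lemma tor_of_test {N : ModuleCat.{u} R} {n : ℕ} (h : TorVanish R (testMod R) N n) (I : Ideal R) :
    TorVanish R (ModuleCat.of R (R ⧸ I)) N n := by
  classical
  unfold TorVanish at *
  let i : ModuleCat.of R (R ⧸ I) ⟶ testMod R :=
    ModuleCat.ofHom (DFinsupp.lsingle (R := R) (M := fun I : Ideal R => R ⧸ I) I)
  let p : testMod R ⟶ ModuleCat.of R (R ⧸ I) :=
    ModuleCat.ofHom (DFinsupp.lapply (R := R) (M := fun I : Ideal R => R ⧸ I) I)
  have hip : i ≫ p = 𝟙 _ := by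
    ext : 1
    apply LinearMap.ext
    intro x
    simp [i, p]
  rw [subsingleton_iff_isZero'] at *
  have e : ((Tor (ModuleCat.{u} R) n).map i).app N ≫ ((Tor (ModuleCat.{u} R) n).map p).app N
      = 𝟙 _ := by
    rw [← NatTrans.comp_app, ← Functor.map_comp, hip, CategoryTheory.Functor.map_id, NatTrans.id_app]
  rw [IsZero.iff_id_eq_zero, ← e, h.eq_of_tgt (((Tor (ModuleCat.{u} R) n).map i).app N) 0,
    zero_comp]

lemma sInf_le_coe {S : Set ℕ} {n : ℕ} (h : sInf ((fun k : ℕ => (k : ℕ∞)) '' S) ≤ n) :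
    ∃ m ∈ S, m ≤ n := by
  have h' : sInf ((fun k : ℕ => (k : ℕ∞)) '' S) < ((n + 1 : ℕ) : ℕ∞) :=
    lt_of_le_of_lt h (by exact_mod_cast Nat.lt_succ_self n)
  obtain ⟨_, ⟨m, hm, rfl⟩, hlt⟩ := sInf_lt_iff.1 h'
  dsimp only at hlt
  exact ⟨m, hm, by have : m < n + 1 := by exact_mod_cast hlt
                   omega⟩

lemma le_of_forall_nat {a b : ℕ∞} (h : ∀ n : ℕ, b ≤ n → a ≤ n) : a ≤ b := by
  induction b with
  | top => exact le_top
  | coe n => exact h n le_rfl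

end Helpers

/-- If every flat `R`-module is projective (`R` is perfect), then the weak global
dimension of `R` equals the global dimension of `R`. -/
theorem stmt_0 (R : Type u) [CommRing R]
    (hperf : ∀ M : ModuleCat.{u} R, Module.Flat R M → Module.Projective R M) :
    wdim R = gldim R := by
  apply le_antisymm
  · apply le_of_forall_nat
    intro n hn
    refine iSup_le fun M => sInf_le ⟨n, ?_, rfl⟩
    intro N
    obtain ⟨m, hm, hmn⟩ := sInf_le_coe ((le_iSup (fun M => pd R M) N).trans hn)
    exact ((HtpyAt.of_ext (ProjectiveResolution.of N) hm).mono _ hmn).tor _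
  · apply le_of_forall_nat
    intro n hn
    obtain ⟨m, hm, hmn⟩ := sInf_le_coe ((le_iSup (fun M => fd R M) (testMod R)).trans hn)
    refine iSup_le fun N => le_trans (sInf_le ⟨m, ?_, rfl⟩) (by exact_mod_cast hmn)
    let P := ProjectiveResolution.of N
    have hp : Module.Projective R (P.complex.X m) :=
      (IsProjective.iff_projective _).2 (P.projective m)
    have hflat := flat_coker (P.complex.d (m + 2) (m + 1)).hom (P.complex.d (m + 1) m).hom
      (by rw [← ModuleCat.hom_comp]; simp)
      (fun I => (torVanish_iff P m).1 (tor_of_test (hm N) I))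
    have hproj := hperf (ModuleCat.of R _) hflat
    exact fun K => (HtpyAt.of_projective P hproj).ext P
end

section
/- For any commutative ring R, gldim(R) ≤ cot.D(R) + wdim(R), where cot.D(R) denotes the supremum of projective dimensions of flat R-modules. -/
open CategoryTheory Opposite

section aux
variable (R : Type u) [CommRing R]

lemma aux_extVanish_iff (M N : ModuleCat.{u} R) (n : ℕ) :
    ExtVanish R M N (n + 1) ↔ Subsingleton (Abelian.Ext.{u} M N (n + 1)) := by
  let P := projectiveResolution M
  have h1 : ExtVanish R M N (n + 1) ↔
      ∀ f : P.complex.X (n + 1) ⟶ N, P.complex.d (n + 2) (n + 1) ≫ f = 0 →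
        ∃ g : P.complex.X n ⟶ N, P.complex.d (n + 1) n ≫ g = f := by
    unfold ExtVanish
    rw [← ModuleCat.isZero_iff_subsingleton, (P.isoExt (R := R) (n + 1) N).isZero_iff,
      ← HomologicalComplex.exactAt_iff_isZero_homology,
      HomologicalComplex.exactAt_iff' _ n (n + 1) (n + 2) (by simp) (by simp),
      ShortComplex.moduleCat_exact_iff]
    rfl
  rw [h1]
  constructor
  · intro h
    refine subsingleton_of_forall_eq 0 fun α => ?_
    obtain ⟨f, hf, rfl⟩ := P.extMk_surjective α (n + 2) rfl
    exact (P.extMk_eq_zero_iff f (n + 2) rfl hf n rfl).2 (h f hf)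
  · intro h f hf
    exact (P.extMk_eq_zero_iff f (n + 2) rfl hf n rfl).1 (Subsingleton.elim _ _)

lemma aux_pdLE_iff (M : ModuleCat.{u} R) (n : ℕ) :
    pdLE R M n ↔ HasProjectiveDimensionLE M n := by
  unfold pdLE
  simp only [aux_extVanish_iff]
  exact ⟨fun h => hasProjectiveDimensionLT_of_enoughInjectives M (n + 1) h,
    fun h N => HasProjectiveDimensionLT.subsingleton M (n + 1) (n + 1) le_rfl N⟩

lemma aux_tor {M N : ModuleCat.{u} R} (P : ProjectiveResolution N) (n : ℕ)
    (h : TorVanish R M N (n + 1)) :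
    Function.Exact ((P.complex.d (n + 2) (n + 1)).hom.lTensor M)
      ((P.complex.d (n + 1) n).hom.lTensor M) := by
  unfold TorVanish at h
  rw [← ModuleCat.isZero_iff_subsingleton] at h
  have h2 := h.of_iso
    (P.isoLeftDerivedObj ((MonoidalCategory.tensoringLeft _).obj M) (n + 1)).symm
  have h3 := (HomologicalComplex.exactAt_iff_isZero_homology _ _).2 h2
  rw [HomologicalComplex.exactAt_iff' _ (n + 2) (n + 1) n (by simp) (by simp),
    ShortComplex.ShortExact.moduleCat_exact_iff_function_exact] at h3
  exact h3

lemma aux_retract {M N P2 P1 P0 : Type u} [AddCommGroup M] [AddCommGroup N] [AddCommGroup P2]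
    [AddCommGroup P1] [AddCommGroup P0] [Module R M] [Module R N] [Module R P2] [Module R P1]
    [Module R P0] (f : P2 →ₗ[R] P1) (g : P1 →ₗ[R] P0) (j : N →ₗ[R] M) (p : M →ₗ[R] N)
    (hpj : p ∘ₗ j = LinearMap.id)
    (h : Function.Exact (f.lTensor M) (g.lTensor M)) (k : TensorProduct R N P1)
    (hk : g.lTensor N k = 0) : ∃ l, f.lTensor N l = k := by
  have e : g.lTensor M (j.rTensor P1 k) = 0 := by
    have := congrArg (j.rTensor P0) hk
    rw [map_zero, ← LinearMap.comp_apply, LinearMap.rTensor_comp_lTensor,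
      ← LinearMap.lTensor_comp_rTensor] at this
    exact this
  obtain ⟨l, hl⟩ := (h _).1 e
  refine ⟨p.rTensor P2 l, ?_⟩
  have := congrArg (p.rTensor P1) hl
  rw [← LinearMap.comp_apply, LinearMap.rTensor_comp_lTensor,
      ← LinearMap.lTensor_comp_rTensor, ← LinearMap.comp_apply, ← LinearMap.rTensor_comp, hpj] at this
  rw [LinearMap.comp_apply] at this
  rw [this, LinearMap.rTensor_id, LinearMap.id_apply]

lemma aux_flat {P2 P1 P0 Z : Type u} [AddCommGroup Z] [AddCommGroup P2]
    [AddCommGroup P1] [AddCommGroup P0] [Module R Z] [Module R P2] [Module R P1]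
    [Module R P0] [Module.Flat R P0] (f : P2 →ₗ[R] P1) (g : P1 →ₗ[R] P0) (q : P0 →ₗ[R] Z)
    (hfg : g ∘ₗ f = 0) (hgq : Function.Exact g q) (hq : Function.Surjective q)
    (H : ∀ (I : Ideal R) (k : TensorProduct R (R ⧸ I) P1), g.lTensor (R ⧸ I) k = 0 →
      ∃ l, f.lTensor (R ⧸ I) l = k) : Module.Flat R Z := by
  rw [Module.Flat.iff_rTensor_injective']
  intro I
  rw [injective_iff_map_eq_zero]
  intro x hx
  have comm : ∀ {A B C D : Type u} [AddCommGroup A] [AddCommGroup B] [AddCommGroup C]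
      [AddCommGroup D] [Module R A] [Module R B] [Module R C] [Module R D]
      (a : A →ₗ[R] B) (b : C →ₗ[R] D) (t : TensorProduct R A C),
      a.rTensor D (b.lTensor A t) = b.lTensor B (a.rTensor C t) := by
    intro A B C D _ _ _ _ _ _ _ _ a b t
    rw [← LinearMap.comp_apply, LinearMap.rTensor_comp_lTensor,
      ← LinearMap.lTensor_comp_rTensor, LinearMap.comp_apply]
  have exI : Function.Exact I.subtype I.mkQ := LinearMap.exact_subtype_mkQ I
  have exP1 := rTensor_exact P1 exI I.mkQ_surjective
  have exP0 := rTensor_exact P0 exI I.mkQ_surjective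
  obtain ⟨y, rfl⟩ := LinearMap.lTensor_surjective I hq x
  rw [comm] at hx
  obtain ⟨k, hk⟩ := (lTensor_exact R hgq hq _).1 hx
  have h1 : g.lTensor (R ⧸ I) (I.mkQ.rTensor P1 k) = 0 := by
    rw [← comm, hk]; exact exP0.apply_apply_eq_zero y
  obtain ⟨l', hl'⟩ := H I _ h1
  obtain ⟨l, rfl⟩ := LinearMap.rTensor_surjective P2 I.mkQ_surjective l'
  rw [← comm] at hl'
  obtain ⟨k', hk'⟩ := (exP1 (k - f.lTensor R l)).1 (by rw [map_sub, hl', sub_self])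
  have h2 : g.lTensor R (f.lTensor R l) = 0 := by
    rw [← LinearMap.comp_apply, ← LinearMap.lTensor_comp, hfg]; simp
  have h3 : g.lTensor I k' = y := by
    apply Module.Flat.rTensor_preserves_injective_linearMap (M := P0) I.subtype I.subtype_injective
    rw [comm, hk', map_sub, h2, hk, sub_zero]
  rw [← h3]
  exact (lTensor_exact I hgq hq).apply_apply_eq_zero k'

lemma aux_syz {N : ModuleCat.{u} R} (P : ProjectiveResolution N) (n m : ℕ)
    (h : HasProjectiveDimensionLE (P.complex.opcycles n) m) : HasProjectiveDimensionLE N (m + n) := by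
  have step : ∀ i k, HasProjectiveDimensionLE (P.complex.opcycles (i + 1)) k →
      HasProjectiveDimensionLE (P.complex.opcycles i) (k + 1) := by
    intro i k hk
    let S : ShortComplex (ModuleCat.{u} R) :=
      ShortComplex.mk (P.complex.fromOpcycles (i + 1) i) (P.complex.pOpcycles i) (by
        rw [← cancel_epi (P.complex.pOpcycles (i + 1))]; simp)
    have hm : Mono S.f := by
      have hex := P.exact_succ i
      rw [ShortComplex.moduleCat_exact_iff] at hex
      rw [ModuleCat.mono_iff_injective, injective_iff_map_eq_zero]
      intro x hx
      obtain ⟨y, rfl⟩ := (ModuleCat.epi_iff_surjective (P.complex.pOpcycles (i + 1))).1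
        inferInstance x
      have hy : (P.complex.d (i + 1) i) y = 0 := by
        rw [← P.complex.p_fromOpcycles]; exact hx
      obtain ⟨z, rfl⟩ := hex y hy
      have := P.complex.d_pOpcycles (i + 2) (i + 1)
      exact congrArg (fun t => t.hom z) this
    have he : Epi S.g := by dsimp [S]; infer_instance
    have hex : S.Exact := by
      apply ShortComplex.exact_of_g_is_cokernel
      refine Limits.CokernelCofork.IsColimit.ofπ _ _
        (fun a ha => P.complex.descOpcycles a (i + 1) (by simp) (by
          rw [← P.complex.p_fromOpcycles, Category.assoc]; erw [ha]; simp)) ?_ ?_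
      · intro _ a ha; simp [S]
      · intro _ a ha b hb
        rw [← cancel_epi (P.complex.pOpcycles i)]
        simpa [S] using hb
    have hS : S.ShortExact := ⟨hex⟩
    have := P.projective i
    exact hS.hasProjectiveDimensionLT_X₃ (k + 1) hk
      (hasProjectiveDimensionLT_of_ge (P.complex.X i) 1 _ (by omega))
  have main : ∀ n m, HasProjectiveDimensionLE (P.complex.opcycles n) m →
      HasProjectiveDimensionLE (P.complex.opcycles 0) (m + n) := by
    intro n
    induction n with
    | zero => exact fun m h => h
    | succ n ih =>
      intro m h
      have := ih _ (step n m h)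
      rwa [show m + (n + 1) = m + 1 + n by omega]
  have := main n m h
  let e : P.complex.opcycles 0 ≅ N :=
    (P.complex.opcyclesIsCokernel 1 0 (by simp)).coconePointUniqueUpToIso P.isColimitCokernelCofork
  exact hasProjectiveDimensionLT_of_iso e _

lemma aux_exists {S : Set ℕ} {c : ℕ} (h : sInf ((↑) '' S : Set ℕ∞) ≤ c) : ∃ n ∈ S, n ≤ c := by
  by_contra! hc
  have : ((c + 1 : ℕ) : ℕ∞) ≤ sInf ((↑) '' S : Set ℕ∞) := by
    apply le_sInf
    rintro _ ⟨n, hn, rfl⟩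
    exact_mod_cast hc n hn
  have := this.trans h
  norm_cast at this
  omega

end aux

/-- For any commutative ring `R`, `gldim R ≤ cot.D R + wdim R`. -/
theorem stmt_2 (R : Type u) [CommRing R] :
    gldim R ≤ cotD R + wdim R := by
  classical
  by_cases hc : cotD R = ⊤
  · simp [hc]
  by_cases hw : wdim R = ⊤
  · simp [hw]
  obtain ⟨c, hc⟩ := ENat.ne_top_iff_exists.1 hc
  obtain ⟨w, hw⟩ := ENat.ne_top_iff_exists.1 hw
  refine iSup_le fun N => ?_
  let T : ModuleCat.{u} R := ModuleCat.of R (Π₀ I : Ideal R, R ⧸ I)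
  have hT : fd R T ≤ w := by
    rw [hw]; exact le_iSup (fun M => fd R M) T
  obtain ⟨n, hn, hnw⟩ := aux_exists hT
  let P := projectiveResolution N
  have hex := aux_tor R P n (hn N)
  have hflat : Module.Flat R (P.complex.opcycles n) := by
    have : Projective (P.complex.X n) := P.projective n
    have : Module.Projective R (P.complex.X n) := (IsProjective.iff_projective _).2 this
    have hcok := ShortComplex.exact_of_g_is_cokernel
      (ShortComplex.mk (P.complex.d (n + 1) n) (P.complex.pOpcycles n) (by simp))
      (P.complex.opcyclesIsCokernel (n + 1) n (by simp))
    rw [ShortComplex.ShortExact.moduleCat_exact_iff_function_exact] at hcok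
    refine aux_flat R (P.complex.d (n + 2) (n + 1)).hom (P.complex.d (n + 1) n).hom
      (P.complex.pOpcycles n).hom ?_ hcok ((ModuleCat.epi_iff_surjective _).1 inferInstance) ?_
    · rw [← ModuleCat.hom_comp, P.complex.d_comp_d]; rfl
    · intro I k hk
      refine aux_retract R _ _ (DFinsupp.lsingle I) (DFinsupp.lapply I) ?_ hex k hk
      ext; exact DFinsupp.single_eq_same
  have hZ : pd R (P.complex.opcycles n) ≤ c := by
    rw [hc]; exact le_iSup₂ (f := fun (M : ModuleCat.{u} R) (_ : Module.Flat R M) => pd R M) _ hflat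
  obtain ⟨m, hm, hmc⟩ := aux_exists hZ
  have := (aux_pdLE_iff R N (m + n)).2 (aux_syz R P n m ((aux_pdLE_iff R _ _).1 hm))
  calc pd R N ≤ ((m + n : ℕ) : ℕ∞) := sInf_le ⟨_, this, rfl⟩
    _ ≤ _ := by rw [← hc, ← hw]; exact_mod_cast Nat.add_le_add hmc hnw
end

section
/- Let R be a commutative ring with FFD(R) = 1 and cot.D(R) < FPD(R) < ∞. Then FPD(R) = cot.D(R) + 1. -/
open CategoryTheory Opposite

open CategoryTheory MonoidalCategory in
theorem flat_aux {R : Type u} [CommRing R] {K F M P2 P1 P0 Q : Type u}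
    [AddCommGroup K] [AddCommGroup F] [AddCommGroup M] [AddCommGroup P2] [AddCommGroup P1]
    [AddCommGroup P0] [AddCommGroup Q] [Module R K] [Module R F] [Module R M] [Module R P2]
    [Module R P1] [Module R P0] [Module R Q] [Module.Flat R P0]
    (i : K →ₗ[R] F) (p : F →ₗ[R] M) (hi : Function.Injective i) (hip : Function.Exact i p)
    (hp : Function.Surjective p)
    (d2 : P2 →ₗ[R] P1) (d1 : P1 →ₗ[R] P0) (e : P0 →ₗ[R] Q)
    (hd : d1 ∘ₗ d2 = 0)
    (hde : Function.Exact d1 e) (he : Function.Surjective e)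
    (hM : Function.Exact (d2.lTensor M) (d1.lTensor M)) :
    Function.Injective (i.rTensor Q) := by
  have comm : ∀ {A B C D : Type u} [AddCommGroup A] [AddCommGroup B] [AddCommGroup C]
      [AddCommGroup D] [Module R A] [Module R B] [Module R C] [Module R D]
      (f : A →ₗ[R] B) (g : C →ₗ[R] D) (x : TensorProduct R A C),
      g.lTensor B (f.rTensor C x) = f.rTensor D (g.lTensor A x) := by
    intros
    rw [← LinearMap.comp_apply, ← LinearMap.comp_apply, LinearMap.lTensor_comp_rTensor,
      LinearMap.rTensor_comp_lTensor]
  rw [injective_iff_map_eq_zero]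
  intro x hx
  obtain ⟨x0, rfl⟩ := LinearMap.lTensor_surjective K he x
  rw [← comm] at hx
  obtain ⟨y1, hy1⟩ := (lTensor_exact F hde he _).1 hx
  have h1 : d1.lTensor M (p.rTensor P1 y1) = 0 := by
    rw [comm, hy1]
    exact (rTensor_exact P0 hip hp).apply_apply_eq_zero x0
  obtain ⟨m2, hm2⟩ := (hM _).1 h1
  obtain ⟨y2, rfl⟩ := LinearMap.rTensor_surjective P2 hp m2
  have h2 : p.rTensor P1 (y1 - d2.lTensor F y2) = 0 := by
    rw [map_sub, ← comm, hm2, sub_self]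
  obtain ⟨k1, hk1⟩ := (rTensor_exact P1 hip hp _).1 h2
  have h3 : d1.lTensor K k1 = x0 := by
    apply Module.Flat.rTensor_preserves_injective_linearMap (M := P0) i hi
    rw [← comm, hk1, map_sub, hy1, ← LinearMap.comp_apply (d1.lTensor F), ← LinearMap.lTensor_comp,
      hd]
    simp
  rw [← h3]
  exact (lTensor_exact K hde he).apply_apply_eq_zero k1

theorem flat_aux2 {R : Type u} [CommRing R] {K F M : Type u}
    [AddCommGroup K] [AddCommGroup F] [AddCommGroup M] 
    [Module R K] [Module R F] [Module R M] [Module.Flat R F]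
    (i : K →ₗ[R] F) (p : F →ₗ[R] M) (hip : Function.Exact i p)
    (hp : Function.Surjective p)
    (h : ∀ (Q : Type u) [AddCommGroup Q] [Module R Q], Function.Injective (i.rTensor Q)) :
    Module.Flat R M := by
  have comm : ∀ {A B C D : Type u} [AddCommGroup A] [AddCommGroup B] [AddCommGroup C]
      [AddCommGroup D] [Module R A] [Module R B] [Module R C] [Module R D]
      (f : A →ₗ[R] B) (g : C →ₗ[R] D) (x : TensorProduct R A C),
      g.lTensor B (f.rTensor C x) = f.rTensor D (g.lTensor A x) := by
    intros
    rw [← LinearMap.comp_apply, ← LinearMap.comp_apply, LinearMap.lTensor_comp_rTensor,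
      LinearMap.rTensor_comp_lTensor]
  rw [Module.Flat.iff_lTensor_injective']
  intro I
  rw [injective_iff_map_eq_zero]
  intro x hx
  have hI : Function.Exact I.subtype I.mkQ := LinearMap.exact_subtype_mkQ I
  have hs := I.mkQ_surjective
  obtain ⟨y, rfl⟩ := LinearMap.rTensor_surjective I hp x
  rw [comm] at hx
  obtain ⟨z, hz⟩ := (rTensor_exact R hip hp _).1 hx
  have h1 : I.mkQ.lTensor K z = 0 := by
    apply h
    rw [← comm, hz, map_zero]
    exact (lTensor_exact F hI hs).apply_apply_eq_zero y
  obtain ⟨w, rfl⟩ := (lTensor_exact K hI hs _).1 h1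
  have h2 : i.rTensor I w = y := by
    apply Module.Flat.lTensor_preserves_injective_linearMap (M := F) I.subtype
      I.injective_subtype
    rw [comm, hz]
  rw [← h2]
  exact (rTensor_exact I hip hp).apply_apply_eq_zero w

open CategoryTheory MonoidalCategory

theorem torVanish_iff_s5 (R : Type u) [CommRing R] (M N : ModuleCat.{u} R)
    (P : ProjectiveResolution N) (n : ℕ) :
    TorVanish R M N n ↔
      (((tensoringLeft (ModuleCat.{u} R)).obj M).mapHomologicalComplex _ |>.obj
        P.complex).ExactAt n := by
  rw [HomologicalComplex.exactAt_iff_isZero_homology, TorVanish, ← ModuleCat.isZero_iff_subsingleton]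
  exact (P.isoLeftDerivedObj ((tensoringLeft (ModuleCat.{u} R)).obj M) n).isZero_iff

theorem torVanish_flat (R : Type u) [CommRing R] (M N : ModuleCat.{u} R) [Module.Flat R M]
    (n : ℕ) : TorVanish R M N (n + 1) := by
  have P := ProjectiveResolution.of N
  rw [torVanish_iff_s5 R M N P,
    HomologicalComplex.exactAt_iff' _ (n + 2) (n + 1) n (by simp) (by simp)]
  have h := Module.Flat.lTensor_exact M
    ((ShortComplex.ShortExact.moduleCat_exact_iff_function_exact _).1 (P.exact_succ n))
  exact (ShortComplex.ShortExact.moduleCat_exact_iff_function_exact _).2 h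

theorem tensor_zero_aux (R : Type u) [CommRing R] (S : ShortComplex (ModuleCat.{u} R))
    (X : ModuleCat.{u} R) : S.f ▷ X ≫ S.g ▷ X = 0 := by
  rw [← comp_whiskerRight, S.zero, MonoidalPreadditive.zero_whiskerRight]

theorem tor_shift (R : Type u) [CommRing R] (S : ShortComplex (ModuleCat.{u} R))
    (hS : S.ShortExact) [Module.Flat R S.X₂] (N : ModuleCat.{u} R) (n : ℕ) :
    TorVanish R S.X₃ N (n + 2) ↔ TorVanish R S.X₁ N (n + 1) := by
  let P := ProjectiveResolution.of N
  let T : ShortComplex (ChainComplex (ModuleCat.{u} R) ℕ) :=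
    { X₁ := (((tensoringLeft (ModuleCat.{u} R)).obj S.X₁).mapHomologicalComplex _).obj P.complex
      X₂ := (((tensoringLeft (ModuleCat.{u} R)).obj S.X₂).mapHomologicalComplex _).obj P.complex
      X₃ := (((tensoringLeft (ModuleCat.{u} R)).obj S.X₃).mapHomologicalComplex _).obj P.complex
      f := (NatTrans.mapHomologicalComplex ((tensoringLeft (ModuleCat.{u} R)).map S.f) _).app _
      g := (NatTrans.mapHomologicalComplex ((tensoringLeft (ModuleCat.{u} R)).map S.g) _).app _
      zero := by
        ext i : 1
        exact tensor_zero_aux R S (P.complex.X i) }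
  have hT : T.ShortExact := by
    apply HomologicalComplex.shortExact_of_degreewise_shortExact
    intro i
    have : Module.Flat R (P.complex.X i) := by
      have : Module.Projective R (P.complex.X i) :=
        (IsProjective.iff_projective _).2 (P.projective i)
      infer_instance
    exact hS.map_of_exact (tensorRight (P.complex.X i))
  have h2 : ∀ k, CategoryTheory.Limits.IsZero (T.X₂.homology (k + 1)) := fun k => by
    rw [← HomologicalComplex.exactAt_iff_isZero_homology]
    exact (torVanish_iff_s5 R S.X₂ N P (k + 1)).1 (torVanish_flat R _ N k)
  have e := hT.δIso (n + 2) (n + 1) rfl (h2 (n + 1)) (h2 n)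
  rw [torVanish_iff_s5 R _ N P, torVanish_iff_s5 R _ N P,
    HomologicalComplex.exactAt_iff_isZero_homology, HomologicalComplex.exactAt_iff_isZero_homology]
  exact e.isZero_iff

theorem flat_of_tor (R : Type u) [CommRing R] (M : ModuleCat.{u} R) (h : fdLE R M 0) :
    Module.Flat R M := by
  let S := M.projectiveShortComplex
  have hS : S.ShortExact := M.shortExact_projectiveShortComplex
  have : Module.Projective R S.X₂ := (IsProjective.iff_projective _).2 inferInstance
  have : Module.Flat R S.X₂ := inferInstance
  have hex := (ShortComplex.ShortExact.moduleCat_exact_iff_function_exact _).1 hS.exact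
  refine flat_aux2 S.f.hom S.g.hom hex hS.moduleCat_surjective_g ?_
  intro Q _ _
  let P := ProjectiveResolution.of (ModuleCat.of R Q)
  have : Module.Projective R (P.complex.X 0) :=
    (IsProjective.iff_projective _).2 (P.projective 0)
  have : Module.Flat R (P.complex.X 0) := inferInstance
  refine flat_aux (P2 := P.complex.X 2) (P1 := P.complex.X 1) (P0 := P.complex.X 0)
    S.f.hom S.g.hom hS.moduleCat_injective_f hex hS.moduleCat_surjective_g
    (P.complex.d 2 1).hom (P.complex.d 1 0).hom (P.π.f 0).hom ?_ ?_ ?_ ?_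
  · rw [← ModuleCat.hom_comp, P.complex.d_comp_d]; rfl
  · exact (ShortComplex.ShortExact.moduleCat_exact_iff_function_exact _).1
      (ShortComplex.exact_of_g_is_cokernel (ShortComplex.mk _ _ P.complex_d_comp_π_f_zero)
        P.isColimitCokernelCofork)
  · exact (ModuleCat.epi_iff_surjective _).1 inferInstance
  · have := (torVanish_iff_s5 R M _ P 1).1 (h (ModuleCat.of R Q))
    rw [HomologicalComplex.exactAt_iff' _ 2 1 0 (by simp) (by simp)] at this
    exact (ShortComplex.ShortExact.moduleCat_exact_iff_function_exact _).1 this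

theorem extVanish_iff_s5 (R : Type u) [CommRing R] (M N : ModuleCat.{u} R) (n : ℕ) :
    ExtVanish R M N (n + 1) ↔ Subsingleton (Abelian.Ext.{u} M N (n + 1)) := by
  let P := ProjectiveResolution.of M
  have h1 : ExtVanish R M N (n + 1) ↔ ∀ f : P.complex.X (n + 1) ⟶ N,
      P.complex.d (n + 2) (n + 1) ≫ f = 0 →
        ∃ g : P.complex.X n ⟶ N, P.complex.d (n + 1) n ≫ g = f := by
    rw [ExtVanish, ← ModuleCat.isZero_iff_subsingleton, (P.isoExt (n + 1) N).isZero_iff,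
      ← HomologicalComplex.exactAt_iff_isZero_homology,
      HomologicalComplex.exactAt_iff' _ n (n + 1) (n + 2) (by simp) (by simp),
      ShortComplex.moduleCat_exact_iff]
    rfl
  rw [h1]
  constructor
  · intro h
    refine ⟨fun a b => ?_⟩
    have : ∀ a : Abelian.Ext.{u} M N (n + 1), a = 0 := by
      intro a
      obtain ⟨f, hf, rfl⟩ := P.extMk_surjective a (n + 2) rfl
      exact (P.extMk_eq_zero_iff f (n + 2) rfl hf n rfl).2 (h f hf)
    rw [this a, this b]
  · intro h f hf
    exact (P.extMk_eq_zero_iff f (n + 2) rfl hf n rfl).1 (Subsingleton.elim _ _)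

theorem pdLE_iff (R : Type u) [CommRing R] (M : ModuleCat.{u} R) (n : ℕ) :
    pdLE R M n ↔ HasProjectiveDimensionLE M n := by
  simp only [pdLE, extVanish_iff_s5]
  exact ⟨fun h => hasProjectiveDimensionLT_of_enoughInjectives M (n + 1) h,
    fun h N => HasProjectiveDimensionLT.subsingleton M (n + 1) (n + 1) le_rfl N⟩

theorem fdLE_of_pd (R : Type u) [CommRing R] (M : ModuleCat.{u} R) (n : ℕ)
    (h : HasProjectiveDimensionLE M n) : fdLE R M n := by
  induction n generalizing M with
  | zero =>
    intro N
    have : Module.Projective R M :=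
      (IsProjective.iff_projective _).2 ((projective_iff_hasProjectiveDimensionLE_zero M).2 h)
    exact torVanish_flat R M N 0
  | succ n ih =>
    intro N
    have hS := M.shortExact_projectiveShortComplex
    have : Module.Projective R M.projectiveShortComplex.X₂ :=
      (IsProjective.iff_projective _).2 inferInstance
    exact (tor_shift R _ hS N n).2
      (ih _ ((hS.hasProjectiveDimensionLT_X₃_iff n inferInstance).1 h) N)

theorem dim_attained (p : ℕ → Prop) (h : sInf ((fun n : ℕ => (n : ℕ∞)) '' {n | p n}) ≠ ⊤) :
    ∃ n : ℕ, p n ∧ sInf ((fun n : ℕ => (n : ℕ∞)) '' {n | p n}) = n := by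
  have hne : ((fun n : ℕ => (n : ℕ∞)) '' {n | p n}).Nonempty := by
    by_contra h'
    rw [Set.not_nonempty_iff_eq_empty] at h'
    rw [h', sInf_empty] at h
    exact h rfl
  obtain ⟨n, hn, hn'⟩ := csInf_mem hne
  exact ⟨n, hn, hn'.symm⟩

/-- If `FFD R = 1` and `cot.D R < FPD R < ∞`, then `FPD R = cot.D R + 1`. -/
theorem stmt_5 (R : Type u) [CommRing R]
    (h1 : FFD R = 1) (h2 : cotD R < FPD R) (h3 : FPD R < ⊤) :
    FPD R = cotD R + 1 := by
  apply le_antisymm _ (Order.add_one_le_of_lt h2)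
  have hflat : ∀ F : ModuleCat.{u} R, Module.Flat R F → pd R F ≤ cotD R := fun F hF =>
    le_iSup₂_of_le F hF le_rfl
  have hc : cotD R ≠ ⊤ := (h2.trans h3).ne
  refine sSup_le ?_
  rintro d ⟨hd, M, rfl⟩
  obtain ⟨n, hn, -⟩ := dim_attained _ hd
  have hfd := fdLE_of_pd R M n ((pdLE_iff R M n).1 hn)
  have hft : fd R M ≠ ⊤ :=
    ne_top_of_le_ne_top (ENat.natCast_ne_top n) (sInf_le ⟨n, hfd, rfl⟩)
  have hle : fd R M ≤ 1 := h1 ▸ le_sSup ⟨hft, M, rfl⟩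
  obtain ⟨m, hm, hm'⟩ := dim_attained _ hft
  have hm1 : m ≤ 1 := by
    have : (m : ℕ∞) ≤ 1 := hm' ▸ hle
    exact_mod_cast this
  obtain rfl | rfl : m = 0 ∨ m = 1 := by lia
  · exact (hflat M (flat_of_tor R M hm)).trans le_self_add
  · have hS := M.shortExact_projectiveShortComplex
    have : Module.Projective R M.projectiveShortComplex.X₂ :=
      (IsProjective.iff_projective _).2 inferInstance
    have hK : Module.Flat R M.projectiveShortComplex.X₁ :=
      flat_of_tor R _ fun N => (tor_shift R _ hS N 0).1 (hm N)
    have hKpd := hflat _ hK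
    obtain ⟨k, hk, hk'⟩ := dim_attained _ (ne_top_of_le_ne_top hc hKpd)
    have h4 : pdLE R M (k + 1) := (pdLE_iff R M (k + 1)).2
      ((hS.hasProjectiveDimensionLT_X₃_iff k inferInstance).2 ((pdLE_iff R _ k).1 hk))
    calc pd R M ≤ ((k + 1 : ℕ) : ℕ∞) := sInf_le ⟨k + 1, h4, rfl⟩
      _ = pd R M.projectiveShortComplex.X₁ + 1 := by
        rw [Nat.cast_add, Nat.cast_one]; exact congrArg (· + 1) hk'.symm
      _ ≤ cotD R + 1 := by gcongr
end

section
/- Let R be a commutative ring with finite weak dimension. Then FCD(R) ≤ FID(R), where FCD(R) is the finitistic cotorsion dimension and FID(R) is the finitistic injective dimension. -/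
open CategoryTheory Opposite

section Helpers

open CategoryTheory Limits

universe v' u' v'' u''

theorem aux_isZero_iff {C : Type u'} [Category.{v'} C] [Abelian C] [EnoughProjectives C]
    {D : Type u''} [Category.{v''} D] [Abelian D] (F : C ⥤ D) [F.Additive]
    {X : C} (P : ProjectiveResolution X) (n : ℕ) :
    IsZero ((F.leftDerived (n + 1)).obj X) ↔
      (ShortComplex.mk (F.map (P.complex.d (n + 2) (n + 1))) (F.map (P.complex.d (n + 1) n))
        (by rw [← F.map_comp, P.complex.d_comp_d, F.map_zero])).Exact := by
  rw [(P.isoLeftDerivedObj F (n + 1)).isZero_iff]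
  change IsZero ((((F.mapHomologicalComplex (ComplexShape.down ℕ)).obj P.complex).homology
    (n + 1))) ↔ _
  rw [← HomologicalComplex.exactAt_iff_isZero_homology,
    HomologicalComplex.exactAt_iff' _ (n + 2) (n + 1) n (by simp only [ChainComplex.prev]; rfl)
      (by simp)]
  rfl

theorem aux_shift_quasi {C : Type u'} [Category.{v'} C] [Abelian C]
    {X : C} (P : ProjectiveResolution X) : QuasiIso
    ((ChainComplex.toSingle₀Equiv (ChainComplex.truncate.obj P.complex)
      (cokernel (P.complex.d 2 1))).symm
      ⟨cokernel.π (P.complex.d 2 1), cokernel.condition (P.complex.d 2 1)⟩) := by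
  refine ⟨fun n => ?_⟩
  cases n with
  | zero =>
    rw [ChainComplex.quasiIsoAt₀_iff, ShortComplex.quasiIso_iff_of_zeros']
    · refine (ShortComplex.exact_and_epi_g_iff_of_iso
        (S₂ := ShortComplex.mk (P.complex.d 2 1) (cokernel.π (P.complex.d 2 1))
          (cokernel.condition _)) ?_).2
        ⟨ShortComplex.exact_of_g_is_cokernel _ (cokernelIsCokernel _),
          by dsimp; infer_instance⟩
      refine ShortComplex.isoMk (Iso.refl _) (Iso.refl _) (Iso.refl _) ?_ ?_
      · exact (Category.id_comp _).trans (Category.comp_id _).symm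
      · refine (Category.id_comp _).trans (Eq.trans ?_ (Category.comp_id _).symm)
        exact (ChainComplex.toSingle₀Equiv_symm_apply_f_zero
          (C := ChainComplex.truncate.obj P.complex) (cokernel.π (P.complex.d 2 1))
            (cokernel.condition (P.complex.d 2 1))).symm
    · exact P.complex.shape _ _ (by simp)
    all_goals rfl
  | succ n =>
    rw [quasiIsoAt_iff_exactAt']
    · rw [HomologicalComplex.exactAt_iff' _ (n + 2) (n + 1) n
        (by simp only [ChainComplex.prev]; rfl) (by simp)]
      exact P.exact_succ (n + 1)
    · apply ChainComplex.exactAt_succ_single_obj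

noncomputable def auxShift {C : Type u'} [Category.{v'} C] [Abelian C]
    {X : C} (P : ProjectiveResolution X) :
    ProjectiveResolution (cokernel (P.complex.d 2 1)) where
  complex := ChainComplex.truncate.obj P.complex
  projective n := P.projective (n + 1)
  π := (ChainComplex.toSingle₀Equiv (ChainComplex.truncate.obj P.complex)
      (cokernel (P.complex.d 2 1))).symm
      ⟨cokernel.π (P.complex.d 2 1), cokernel.condition (P.complex.d 2 1)⟩
  quasiIso := aux_shift_quasi P

noncomputable def auxSyz {C : Type u'} [Category.{v'} C] [Abelian C] [EnoughProjectives C] :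
    ℕ → C → C
  | 0, X => X
  | n + 1, X => auxSyz n (cokernel ((ProjectiveResolution.of X).complex.d 2 1))

theorem aux_syz_iff {C : Type u'} [Category.{v'} C] [Abelian C] [EnoughProjectives C]
    {D : Type u''} [Category.{v''} D] [Abelian D] (F : C ⥤ D) [F.Additive] (w n : ℕ) (X : C) :
    IsZero ((F.leftDerived (w + n + 1)).obj X) ↔
      IsZero ((F.leftDerived (n + 1)).obj (auxSyz w X)) := by
  induction w generalizing X with
  | zero => rw [Nat.zero_add]; rfl
  | succ w ih =>
    rw [auxSyz, ← ih, aux_isZero_iff F (auxShift (ProjectiveResolution.of X)),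
      show w + 1 + n + 1 = (w + n + 1) + 1 by omega,
      aux_isZero_iff F (ProjectiveResolution.of X)]
    rfl

theorem aux_flat_s8 {R : Type u'} [CommRing R] {A B E K : Type u'}
    [AddCommGroup A] [AddCommGroup B] [AddCommGroup E] [AddCommGroup K]
    [Module R A] [Module R B] [Module R E] [Module R K] [Module.Flat R E]
    (f : A →ₗ[R] B) (g : B →ₗ[R] E) (p : E →ₗ[R] K) (hfg : g ∘ₗ f = 0)
    (hgp : Function.Exact g p) (hp : Function.Surjective p)
    (H : ∀ I : Ideal R, Function.Exact (f.lTensor (R ⧸ I)) (g.lTensor (R ⧸ I))) :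
    Module.Flat R K := by
  rw [Module.Flat.iff_rTensor_injective']
  intro I
  rw [injective_iff_map_eq_zero]
  intro x hx
  obtain ⟨y, rfl⟩ := LinearMap.lTensor_surjective I hp x
  have comm : ∀ {M N : Type u'} [AddCommGroup M] [AddCommGroup N] [Module R M] [Module R N]
      {S T : Type u'} [AddCommGroup S] [AddCommGroup T] [Module R S] [Module R T]
      (i : S →ₗ[R] T) (q : M →ₗ[R] N) (z), i.rTensor N (q.lTensor S z) =
      q.lTensor T (i.rTensor M z) := by
    intro M N _ _ _ _ S T _ _ _ _ i q z
    rw [← LinearMap.comp_apply, ← LinearMap.comp_apply, LinearMap.rTensor_comp_lTensor,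
      LinearMap.lTensor_comp_rTensor]
  rw [comm] at hx
  obtain ⟨z, hz⟩ := (lTensor_exact R hgp hp _).1 hx
  have hmk : Function.Exact I.subtype I.mkQ := by
    intro r; simp [Ideal.Quotient.eq_zero_iff_mem]
  have hms : Function.Surjective I.mkQ := I.mkQ_surjective
  have h0 : g.lTensor (R ⧸ I) (I.mkQ.rTensor B z) = 0 := by
    rw [← comm, hz]
    exact (rTensor_exact E hmk hms _).2 ⟨y, rfl⟩
  obtain ⟨t, ht⟩ := (H I _).1 h0
  obtain ⟨t', rfl⟩ := LinearMap.rTensor_surjective A hms t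
  have h1 : I.mkQ.rTensor B (z - f.lTensor R t') = 0 := by
    rw [map_sub, comm, ht, sub_self]
  obtain ⟨s, hs⟩ := (rTensor_exact B hmk hms _).1 h1
  have h2 : g.lTensor I s = y := by
    apply Module.Flat.rTensor_preserves_injective_linearMap (M := E) I.subtype
      I.subtype_injective
    rw [comm, hs, map_sub, hz, ← LinearMap.comp_apply, ← LinearMap.lTensor_comp, hfg]
    simp
  rw [← h2, ← LinearMap.comp_apply, ← LinearMap.lTensor_comp, hgp.linearMap_comp_eq_zero]
  simp

end Helpers

section Helpers2

open CategoryTheory Limits Opposite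

universe v

variable {R : Type v} [CommRing R]

theorem aux_tor_iff (M N : ModuleCat.{v} R) (n : ℕ) :
    TorVanish R M N n ↔
      IsZero ((((MonoidalCategory.tensoringLeft (ModuleCat.{v} R)).obj M).leftDerived n).obj N) :=
  (ModuleCat.isZero_iff_subsingleton).symm

theorem aux_ext_iff (M N : ModuleCat.{v} R) (n : ℕ) :
    ExtVanish R M N n ↔
      IsZero ((((linearYoneda R (ModuleCat.{v} R)).obj N).rightOp.leftDerived n).obj M) := by
  refine (ModuleCat.isZero_iff_subsingleton).symm.trans ⟨fun h => ?_, fun h => ?_⟩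
  · exact h.op
  · exact h.unop

theorem aux_tor_shift (M N : ModuleCat.{v} R) (w n : ℕ) :
    TorVanish R M N (w + n + 1) ↔ TorVanish R M (auxSyz w N) (n + 1) := by
  rw [aux_tor_iff, aux_tor_iff, aux_syz_iff]

theorem aux_ext_shift (M N : ModuleCat.{v} R) (w n : ℕ) :
    ExtVanish R M N (w + n + 1) ↔ ExtVanish R (auxSyz w M) N (n + 1) := by
  rw [aux_ext_iff, aux_ext_iff, aux_syz_iff]

theorem aux_flat_of_tor (K : ModuleCat.{v} R) (h : ∀ M, TorVanish R M K 1) :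
    Module.Flat R K := by
  let P := ProjectiveResolution.of K
  have : Projective (P.complex.X 0) := P.projective 0
  have : Module.Projective R (P.complex.X 0) :=
    (IsProjective.iff_projective (R := R) (P.complex.X 0)).2 this
  refine aux_flat_s8 (P.complex.d 2 1).hom (P.complex.d 1 0).hom (P.π.f 0).hom ?_ ?_ ?_ ?_
  · rw [← ModuleCat.hom_comp, P.complex.d_comp_d]; rfl
  · exact (ShortComplex.ShortExact.moduleCat_exact_iff_function_exact _).1 P.exact₀
  · exact (ModuleCat.epi_iff_surjective (P.π.f 0)).1 inferInstance
  · intro I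
    have := (aux_isZero_iff _ P 0).1 ((aux_tor_iff (ModuleCat.of R (R ⧸ I)) K 1).1 (h _))
    exact (ShortComplex.ShortExact.moduleCat_exact_iff_function_exact _).1 this

theorem aux_idLE (w d : ℕ) (hw : ∀ M : ModuleCat.{v} R, fd R M ≤ w)
    (M : ModuleCat.{v} R) (hd : cdLE R M d) : idLE R M (w + d) := by
  intro N
  rw [aux_ext_shift]
  apply hd
  apply aux_flat_of_tor
  intro L
  rw [← Nat.zero_add 1, ← aux_tor_shift]
  obtain ⟨n, hn, hnw⟩ : ∃ n, fdLE R L n ∧ n ≤ w := by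
    have h1 : fd R L < ((w + 1 : ℕ) : ℕ∞) := lt_of_le_of_lt (hw L) (by exact_mod_cast Nat.lt_succ_self w)
    obtain ⟨_, ⟨n, hn, rfl⟩, h2⟩ := sInf_lt_iff.1 h1
    exact ⟨n, hn, by have : n < w + 1 := by exact_mod_cast h2
                     omega⟩
  obtain ⟨k, rfl⟩ := Nat.exists_eq_add_of_le' hnw
  rw [Nat.add_zero, aux_tor_shift]
  exact hn _

end Helpers2

/-- If `R` has finite weak dimension, then `FCD R ≤ FID R`. -/
theorem stmt_8 (R : Type u) [CommRing R] (h : wdim R < ⊤) :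
    FCD R ≤ FID R := by
  obtain ⟨w, hw⟩ := ENat.ne_top_iff_exists.1 h.ne
  have hw' : ∀ M : ModuleCat.{u} R, fd R M ≤ w := fun M => by
    rw [hw]; exact le_iSup (fun M => fd R M) M
  refine sSup_le ?_
  rintro _ ⟨hd, M, rfl⟩
  have h1 : cd R M ≤ injd R M := by
    refine sInf_le_sInf (Set.image_mono ?_)
    intro n hn F _
    exact hn F
  refine h1.trans (le_sSup ⟨?_, M, rfl⟩)
  obtain ⟨_, ⟨d, hd, rfl⟩, -⟩ := sInf_lt_iff.1 (lt_top_iff_ne_top.2 hd)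
  exact ((sInf_le (Set.mem_image_of_mem _ (aux_idLE w d hw' M hd))).trans_lt
    (ENat.natCast_lt_top _)).ne
end
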